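/- Let n ≥ 1 and Y ∈ 𝕎^n, and define u⁰_Y(X;t) = Σ_{σ ∈ S_n} Λ_Y(X;t;σ) for X ∈ ℤ^n and t ≥ 0. Then u⁰_Y satisfies the boundary conditions: for every k ∈ {1,…,n−1}, every x ∈ ℤ, all fixed values of the coordinates other than the k-th and (k+1)-th, and every t ≥ 0: b_{x−1} u⁰_Y((…, x−1, x, …);t) = q b_{x−1} u⁰_Y((…, x, x−1, …);t) + (1−q) b_x u⁰_Y((…, x, x, …);t), where the displayed entries occupy positions k and k+1. -/

import Mathlib

/-- Extended product `∏'_{k=m}^{n} f k`. -/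
noncomputable def eprod (f : ℤ → ℂ) (m n : ℤ) : ℂ :=
  if m ≤ n + 1 then ∏ k ∈ Finset.Icc m n, f k
  else ∏ k ∈ Finset.Icc (n + 1) (m - 1), (f k)⁻¹

/-- `A_σ(w_1,…,w_n)`: product of `S_{(β,α)}` over inversions `(β,α)` of `σ`. -/
noncomputable def Acoef (q : ℝ) {n : ℕ} (σ : Equiv.Perm (Fin n)) (w : Fin n → ℂ) : ℂ :=
  ∏ p ∈ Finset.univ.filter
      (fun p : Fin n × Fin n => p.2 < p.1 ∧ σ⁻¹ p.1 < σ⁻¹ p.2),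
    (-((q : ℂ) * w p.1 - w p.2) / ((q : ℂ) * w p.2 - w p.1))

/-- `B(w_1,…,w_n) = ∏_{i<j} (w_i - w_j)/(w_i - q w_j)`. -/
noncomputable def Bcoef (q : ℝ) {n : ℕ} (w : Fin n → ℂ) : ℂ :=
  ∏ p ∈ Finset.univ.filter (fun p : Fin n × Fin n => p.1 < p.2),
    (w p.1 - w p.2) / (w p.1 - (q : ℂ) * w p.2)

/-- Iterated contour integral over `n` counterclockwise circles of radius `R` centred at `0`,
outermost variable first. -/
noncomputable def mcInt : (n : ℕ) → ℝ → ((Fin n → ℂ) → ℂ) → ℂ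
  | 0, _, f => f (fun i => i.elim0)
  | n + 1, R, f => ∮ z in C(0, R), mcInt n R (fun w => f (Fin.cons z w))

/-- `Λ_Y(X;t;σ)`, with all contours the counterclockwise circle of radius `R`. -/
noncomputable def Lam (q : ℝ) (b : ℤ → ℝ) {n : ℕ} (Y X : Fin n → ℤ)
    (t : ℝ) (σ : Equiv.Perm (Fin n)) (R : ℝ) : ℂ :=
  (∏ k, (-1 : ℂ) / (b (X k) : ℂ)) * (1 / (2 * Real.pi * Complex.I)) ^ n *
    mcInt n R (fun w =>
      Acoef q σ w *
        ∏ j, (eprod (fun k => (b k : ℂ) / ((b k : ℂ) - w (σ j))) (Y (σ j)) (X j) *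
          Complex.exp (-(w j) * (t : ℂ))))

/-- `R` is a valid contour radius for `Λ_Y(X;·;·)`: `R > b k` for every integer `k` in
`[min_j min(x_j, y_j) - 1, max_j max(x_j, y_j)]`. -/
def ValidR (b : ℤ → ℝ) {n : ℕ} (X Y : Fin n → ℤ) (R : ℝ) : Prop :=
  ∀ k : ℤ, (∃ j, min (X j) (Y j) - 1 ≤ k) → (∃ j, k ≤ max (X j) (Y j)) → b k < R

/-- Number of coordinates of `X` equal to `s`. -/
def cnt {n : ℕ} (X : Fin n → ℤ) (s : ℤ) : ℕ :=
  (Finset.univ.filter (fun j => X j = s)).card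

/-- The `q`-deformed factorial `[k]_q! = ∏_{j=1}^{k} (1-q^j)/(1-q)`. -/
noncomputable def qfac (q : ℝ) (k : ℕ) : ℝ :=
  ∏ j ∈ Finset.Icc 1 k, (1 - q ^ j) / (1 - q)

/-- `W(X) = ∏_i [k_i]_q!` over the distinct values of `X` with multiplicities `k_i`. -/
noncomputable def Wcoef (q : ℝ) {n : ℕ} (X : Fin n → ℤ) : ℝ :=
  ∏ s ∈ Finset.univ.image X, qfac q (cnt X s)

/-- For `X` weakly decreasing, `lowerLast X s = X^{K,-}` where the coordinate lowered by `1`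
is the last one equal to `s`. -/
def lowerLast {n : ℕ} (X : Fin n → ℤ) (s : ℤ) : Fin n → ℤ :=
  fun j => if X j = s ∧ ∀ i, j < i → X i ≠ s then X j - 1 else X j

/-- The `q`-TAZRP master equation for a family `P(X;·)`, `X ∈ 𝕎^n`. -/
def MasterEq (q : ℝ) (a : ℤ → ℝ) {n : ℕ} (P : (Fin n → ℤ) → ℝ → ℂ) : Prop :=
  ∀ X : Fin n → ℤ, Antitone X → ∀ t : ℝ, 0 ≤ t →
    HasDerivAt (P X)
      ((∑ s ∈ Finset.univ.image X,
          (1 - (q : ℂ) ^ cnt (lowerLast X s) (s - 1)) * (a (s - 1) : ℂ) * P (lowerLast X s) t) -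
        ∑ s ∈ Finset.univ.image X,
          (1 - (q : ℂ) ^ cnt X s) * (a s : ℂ) * P X t) t

/-- The tuple `X` with coordinates `k` and `k+1` (0-based) replaced by `u` and `v`. -/
def set2 {n : ℕ} (X : Fin n → ℤ) (k : ℕ) (h : k + 1 < n) (u v : ℤ) : Fin n → ℤ :=
  Function.update (Function.update X ⟨k, by omega⟩ u) ⟨k + 1, h⟩ v

/-- The free particle evolution equation. -/
def FreeEvol (b : ℤ → ℝ) {n : ℕ} (u : (Fin n → ℤ) → ℝ → ℂ) : Prop :=
  ∀ X : Fin n → ℤ, ∀ t : ℝ, 0 ≤ t →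
    HasDerivAt (u X)
      (∑ k, ((b (X k - 1) : ℂ) * u (Function.update X k (X k - 1)) t -
        (b (X k) : ℂ) * u X t)) t

/-- The boundary conditions. -/
def BoundaryCond (q : ℝ) (b : ℤ → ℝ) {n : ℕ} (u : (Fin n → ℤ) → ℝ → ℂ) : Prop :=
  ∀ (k : ℕ) (h : k + 1 < n) (X : Fin n → ℤ) (x : ℤ) (t : ℝ), 0 ≤ t →
    (b (x - 1) : ℂ) * u (set2 X k h (x - 1) x) t =
      (q : ℂ) * (b (x - 1) : ℂ) * u (set2 X k h x (x - 1)) t +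
        (1 - (q : ℂ)) * (b x : ℂ) * u (set2 X k h x x) t

/-- The explicit one-particle transition probability. -/
noncomputable def P1 (b : ℤ → ℝ) (y x : ℤ) (t : ℝ) : ℝ :=
  if x < y then 0
  else if x = y then Real.exp (-(b y) * t)
  else (∏ k ∈ Finset.Icc y (x - 1), b k) *
    ∑ k ∈ Finset.Icc y x,
      (∏ j ∈ (Finset.Icc y x).erase k, (b j - b k)⁻¹) * Real.exp (-(b k) * t)

open MeasureTheory

theorem circleIntegral_norm_eq_mul_unit (c : ℂ) (f : ℂ → ℂ) :
    (∮ z in C(0, ‖c‖), f z) = c * ∮ z in C(0, 1), f (c * z) := by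
  have hmap : ∀ θ : ℝ, c * circleMap 0 1 θ = circleMap 0 ‖c‖ (θ + c.arg) := by
    intro θ
    simp only [circleMap, zero_add, Complex.ofReal_one, one_mul, Complex.ofReal_add, add_mul,
      Complex.exp_add]
    conv_lhs => rw [← Complex.norm_mul_exp_arg_mul_I c]
    ring
  have hper : Function.Periodic
      (fun θ : ℝ => deriv (circleMap 0 ‖c‖) θ • f (circleMap 0 ‖c‖ θ)) (2 * Real.pi) := by
    intro θ
    simp only [deriv_circleMap, periodic_circleMap 0 ‖c‖ θ]
  have hshift := hper.intervalIntegral_add_eq 0 c.arg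
  simp only [circleIntegral]
  rw [zero_add] at hshift
  rw [hshift, add_comm c.arg, ← intervalIntegral.integral_const_mul]
  have := intervalIntegral.integral_comp_add_right (a := 0) (b := 2 * Real.pi)
    (fun θ : ℝ => deriv (circleMap 0 ‖c‖) θ • f (circleMap 0 ‖c‖ θ)) c.arg
  rw [zero_add] at this
  rw [← this]
  refine intervalIntegral.integral_congr fun θ _ => ?_
  simp only [deriv_circleMap, smul_eq_mul, ← hmap]
  ring

theorem mcInt_norm_eq_pow_mul_unit (c : ℂ) (n : ℕ) (f : (Fin n → ℂ) → ℂ) :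
    mcInt n ‖c‖ f = c ^ n * mcInt n 1 (fun w => f (c • w)) := by
  induction n with
  | zero =>
    simp only [mcInt, pow_zero, one_mul]
    congr 1
    exact Subsingleton.elim _ _
  | succ n ih =>
    simp only [mcInt]
    rw [circleIntegral_norm_eq_mul_unit]
    simp_rw [ih]
    rw [circleIntegral.integral_const_mul, ← mul_assoc, ← pow_succ']
    congr 2
    funext z
    congr 1
    funext w
    congr 1
    ext i
    refine Fin.cases ?_ (fun i => ?_) i <;> simp

theorem norm_torusMap_zero_apply {n : ℕ} {r : ℝ} (hr : 0 ≤ r) (θ : Fin n → ℝ) (i : Fin n) :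
    ‖torusMap 0 (fun _ => r) θ i‖ = r := by
  simp [torusMap, Complex.norm_exp_ofReal_mul_I, abs_of_nonneg hr]

theorem continuous_torusMap {n : ℕ} (c : Fin n → ℂ) (r : Fin n → ℝ) :
    Continuous (torusMap c r) := by
  unfold torusMap
  fun_prop

theorem torusIntegrable_of_continuousOn {n : ℕ} {r : ℝ} (hr : 0 ≤ r) {f : (Fin n → ℂ) → ℂ}
    (hf : ContinuousOn f {w | ∀ i, ‖w i‖ = r}) : TorusIntegrable f 0 (fun _ => r) := by
  refine ContinuousOn.integrableOn_compact isCompact_Icc (Continuous.continuousOn ?_)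
  exact hf.comp_continuous (continuous_torusMap _ _) (norm_torusMap_zero_apply hr)

theorem torusIntegral_congr {n : ℕ} {r : ℝ} (hr : 0 ≤ r) {f g : (Fin n → ℂ) → ℂ}
    (hfg : ∀ w : Fin n → ℂ, (∀ i, ‖w i‖ = r) → f w = g w) :
    torusIntegral f 0 (fun _ => r) = torusIntegral g 0 (fun _ => r) := by
  refine setIntegral_congr_fun measurableSet_Icc fun θ _ => ?_
  simp only [hfg _ (norm_torusMap_zero_apply hr θ)]

theorem mcInt_eq_torusIntegral {n : ℕ} {r : ℝ} (hr : 0 ≤ r) {f : (Fin n → ℂ) → ℂ}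
    (hf : ContinuousOn f {w | ∀ i, ‖w i‖ = r}) :
    mcInt n r f = torusIntegral f 0 (fun _ => r) := by
  induction n with
  | zero =>
    rw [torusIntegral_dim0]
    exact congrArg f (Subsingleton.elim _ _)
  | succ n ih =>
    rw [torusIntegral_succ (torusIntegrable_of_continuousOn hr hf)]
    refine circleIntegral.integral_congr hr fun z hz => ih ?_
    refine hf.comp (by fun_prop) fun w hw i => ?_
    refine Fin.cases ?_ (fun i => ?_) i
    · simpa using hz
    · simpa using hw i

theorem circleIntegral_torusIntegral_swap {n : ℕ} {r s : ℝ} (hr : 0 ≤ r) (hs : 0 ≤ s)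
    {F : ℂ → (Fin n → ℂ) → ℂ}
    (hF : ContinuousOn (Function.uncurry F) {p | ‖p.1‖ = r ∧ ∀ i, ‖p.2 i‖ = s}) :
    (∮ c in C(0, r), torusIntegral (F c) 0 (fun _ => s)) =
      torusIntegral (fun w => ∮ c in C(0, r), F c w) 0 (fun _ => s) := by
  rw [circleIntegral_def_Icc]
  simp only [torusIntegral, circleIntegral_def_Icc, ← integral_smul]
  rw [integral_integral_swap]
  · simp only [smul_smul, mul_comm]
  · rw [Measure.prod_restrict]
    refine ContinuousOn.integrableOn_compact (isCompact_Icc.prod isCompact_Icc)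
      (Continuous.continuousOn ?_)
    have h1 : Continuous fun p : ℝ × (Fin n → ℝ) =>
        Function.uncurry F (circleMap 0 r p.1, torusMap 0 (fun _ => s) p.2) := by
      refine hF.comp_continuous ?_ fun p => ⟨?_, norm_torusMap_zero_apply hs p.2⟩
      · exact ((continuous_circleMap 0 r).comp continuous_fst).prodMk
          ((continuous_torusMap _ _).comp continuous_snd)
      · simp [abs_of_nonneg hr]
    have h2 : Continuous fun p : ℝ × (Fin n → ℝ) => deriv (circleMap 0 r) p.1 := by
      simp only [deriv_circleMap]
      exact ((continuous_circleMap 0 r).comp continuous_fst).mul continuous_const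
    have h3 : Continuous fun p : ℝ × (Fin n → ℝ) =>
        ∏ i, ((s : ℂ) * Complex.exp (p.2 i * Complex.I) * Complex.I) := by
      fun_prop
    exact h2.smul (h3.smul h1)

/-- A contour integral over equal circles does not depend on the common radius when the integrand
is holomorphic along every complex dilation of the tori in between. -/
theorem mcInt_eq_of_differentiableAt {n : ℕ} {r R : ℝ} (hr : 0 < r) (hrR : r ≤ R)
    {f : (Fin n → ℂ) → ℂ}
    (hf : ∀ ρ, r ≤ ρ → ∀ w : Fin n → ℂ, (∀ i, ‖w i‖ = ρ) → DifferentiableAt ℂ f w) :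
    mcInt n R f = mcInt n r f := by
  have key : ∀ ρ, r ≤ ρ → 2 * Real.pi * Complex.I * mcInt n ρ f =
      torusIntegral (fun w => ∮ c in C(0, ρ), c⁻¹ * (c ^ n * f (c • w))) 0 (fun _ => 1) := by
    intro ρ hρ
    have hρ0 : 0 < ρ := hr.trans_le hρ
    have hc0 : ∀ c : ℂ, ‖c‖ = ρ → c ≠ 0 := fun c hc => norm_pos_iff.1 (hc ▸ hρ0)
    rw [← circleIntegral_torusIntegral_swap hρ0.le zero_le_one]
    · have := circleIntegral.integral_sub_center_inv (0 : ℂ) hρ0.ne'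
      rw [← this, mul_comm, ← circleIntegral.integral_const_mul]
      refine circleIntegral.integral_congr hρ0.le fun c hc => ?_
      have hc' : ‖c‖ = ρ := by simpa using hc
      simp only [sub_zero]
      rw [torusIntegral_const_mul, torusIntegral_const_mul, ← mcInt_eq_torusIntegral zero_le_one,
        ← mcInt_norm_eq_pow_mul_unit, hc', mul_comm]
      intro w hw
      have hd := (hf ρ hρ (c • w) fun i => by simp [hc', hw i]).continuousAt
      exact (ContinuousAt.comp (f := fun w => c • w) hd (by fun_prop)).continuousWithinAt
    · rintro ⟨c, w⟩ ⟨hc, hw⟩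
      have hd := (hf ρ hρ (c • w) fun i => by simpa [hw i] using hc).continuousAt
      have h1 : ContinuousAt (fun p : ℂ × (Fin n → ℂ) => f (p.1 • p.2)) (c, w) :=
        ContinuousAt.comp (f := fun p : ℂ × (Fin n → ℂ) => p.1 • p.2) hd (by fun_prop)
      have h2 : ContinuousAt (fun p : ℂ × (Fin n → ℂ) => p.1⁻¹) (c, w) :=
        continuousAt_fst.inv₀ (hc0 c hc)
      exact (h2.mul ((continuousAt_fst.pow n).mul h1)).continuousWithinAt
  have h2pi : (2 * Real.pi * Complex.I : ℂ) ≠ 0 := by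
    simp [Real.pi_ne_zero, Complex.I_ne_zero]
  refine mul_left_cancel₀ h2pi ?_
  rw [key R hrR, key r le_rfl]
  refine torusIntegral_congr zero_le_one fun w hw => ?_
  have hd : ∀ c : ℂ, r ≤ ‖c‖ → DifferentiableAt ℂ (fun c => c⁻¹ * (c ^ n * f (c • w))) c := by
    intro c hc
    have hc0 : c ≠ 0 := norm_pos_iff.1 (hr.trans_le hc)
    have h1 : DifferentiableAt ℂ (fun c : ℂ => f (c • w)) c :=
      DifferentiableAt.comp (f := fun c : ℂ => c • w) c
        (hf ‖c‖ hc (c • w) fun i => by simp [hw i]) (by fun_prop)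
    exact (differentiableAt_inv hc0).mul ((differentiableAt_id.pow n).mul h1)
  refine Complex.circleIntegral_eq_of_differentiable_on_annulus_off_countable hr hrR
    Set.countable_empty (fun c hc => (hd c ?_).continuousAt.continuousWithinAt)
    fun c hc => hd c ?_
  · simpa using hc.2
  · exact (by simpa using hc.1.2 : r < ‖c‖).le

/-- The integrand of `Lam`. -/
noncomputable def LamIntegrand (q : ℝ) (b : ℤ → ℝ) {n : ℕ} (Y X : Fin n → ℤ)
    (t : ℝ) (σ : Equiv.Perm (Fin n)) (w : Fin n → ℂ) : ℂ :=
  Acoef q σ w *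
    ∏ j, (eprod (fun k => (b k : ℂ) / ((b k : ℂ) - w (σ j))) (Y (σ j)) (X j) *
      Complex.exp (-(w j) * (t : ℂ)))

theorem ofReal_sub_ne_zero_of_lt_norm {x : ℝ} (hx : 0 < x) {w : ℂ} (hw : x < ‖w‖) :
    (x : ℂ) - w ≠ 0 := by
  intro h
  rw [← sub_eq_zero.1 h, Complex.norm_real, Real.norm_of_nonneg hx.le] at hw
  exact lt_irrefl _ hw

theorem ofReal_mul_sub_ne_zero_of_norm_eq {q : ℝ} (hq : q ∈ Set.Ioo (0 : ℝ) 1) {z w : ℂ}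
    (hz : z ≠ 0) (hzw : ‖z‖ = ‖w‖) : (q : ℂ) * z - w ≠ 0 := by
  intro h
  have h1 := congrArg norm (sub_eq_zero.1 h)
  rw [norm_mul, Complex.norm_real, Real.norm_of_nonneg hq.1.le, ← hzw] at h1
  have := norm_pos_iff.2 hz
  nlinarith [hq.2]

theorem DifferentiableAt.finset_prod_apply {E ι : Type*} [NormedAddCommGroup E] [NormedSpace ℂ E]
    {s : Finset ι} {f : ι → E → ℂ} {x : E} (h : ∀ i ∈ s, DifferentiableAt ℂ (f i) x) :
    DifferentiableAt ℂ (fun y => ∏ i ∈ s, f i y) x := by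
  classical
  induction s using Finset.induction_on with
  | empty => simp
  | insert i s hi ih =>
    simp only [Finset.prod_insert hi]
    exact (h i (Finset.mem_insert_self i s)).mul
      (ih fun j hj => h j (Finset.mem_insert_of_mem hj))

theorem DifferentiableAt.div_apply {E : Type*} [NormedAddCommGroup E] [NormedSpace ℂ E]
    {f g : E → ℂ} {x : E} (hf : DifferentiableAt ℂ f x) (hg : DifferentiableAt ℂ g x)
    (h : g x ≠ 0) : DifferentiableAt ℂ (fun y => f y / g y) x := by
  simp only [div_eq_mul_inv]
  exact hf.mul (hg.inv h)

theorem differentiableAt_Acoef {q : ℝ} (hq : q ∈ Set.Ioo (0 : ℝ) 1) {n : ℕ}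
    (σ : Equiv.Perm (Fin n)) {ρ : ℝ} (hρ : 0 < ρ) {w : Fin n → ℂ} (hw : ∀ i, ‖w i‖ = ρ) :
    DifferentiableAt ℂ (Acoef q σ) w := by
  unfold Acoef
  refine DifferentiableAt.finset_prod_apply fun p _ => ?_
  refine DifferentiableAt.div_apply (by fun_prop) (by fun_prop) ?_
  exact ofReal_mul_sub_ne_zero_of_norm_eq hq (norm_pos_iff.1 (by rw [hw]; exact hρ))
    (by rw [hw, hw])

theorem differentiableAt_eprod {b : ℤ → ℝ} (hb : ∀ k, 0 < b k) {n : ℕ} (i : Fin n) {y x : ℤ}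
    {w : Fin n → ℂ} (hw : ∀ k, min x y ≤ k → k ≤ max x y → b k < ‖w i‖) :
    DifferentiableAt ℂ
      (fun w : Fin n → ℂ => eprod (fun k => (b k : ℂ) / ((b k : ℂ) - w i)) y x) w := by
  have hfac : ∀ k, min x y ≤ k → k ≤ max x y →
      DifferentiableAt ℂ (fun w : Fin n → ℂ => (b k : ℂ) / ((b k : ℂ) - w i)) w := fun k h1 h2 =>
    DifferentiableAt.div_apply (by fun_prop) (by fun_prop)
      (ofReal_sub_ne_zero_of_lt_norm (hb k) (hw k h1 h2))
  unfold eprod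
  split_ifs with h
  · refine DifferentiableAt.finset_prod_apply fun k hk => ?_
    rw [Finset.mem_Icc] at hk
    exact hfac k (by omega) (by omega)
  · refine DifferentiableAt.finset_prod_apply fun k hk => ?_
    rw [Finset.mem_Icc] at hk
    refine (hfac k (by omega) (by omega)).inv ?_
    have := hb k
    exact div_ne_zero (by exact_mod_cast this.ne')
      (ofReal_sub_ne_zero_of_lt_norm this (hw k (by omega) (by omega)))

theorem differentiableAt_LamIntegrand {q : ℝ} (hq : q ∈ Set.Ioo (0 : ℝ) 1) {b : ℤ → ℝ}
    (hb : ∀ k, 0 < b k) {n : ℕ} {Y X : Fin n → ℤ} (t : ℝ) (σ : Equiv.Perm (Fin n)) {r ρ : ℝ}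
    (hr : 0 < r) (hX : ValidR b X Y r) (hρ : r ≤ ρ) {w : Fin n → ℂ} (hw : ∀ i, ‖w i‖ = ρ) :
    DifferentiableAt ℂ (LamIntegrand q b Y X t σ) w := by
  unfold LamIntegrand
  refine (differentiableAt_Acoef hq σ (hr.trans_le hρ) hw).mul ?_
  refine DifferentiableAt.finset_prod_apply fun j _ => ?_
  refine DifferentiableAt.mul (differentiableAt_eprod hb (σ j) fun k h1 h2 => ?_) (by fun_prop)
  rw [hw]
  refine (hX k ?_ ?_).trans_le hρ
  · rcases min_le_iff.1 h1 with h | h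
    · exact ⟨j, by omega⟩
    · exact ⟨σ j, by omega⟩
  · rcases le_max_iff.1 h2 with h | h
    · exact ⟨j, by omega⟩
    · exact ⟨σ j, by omega⟩

theorem ValidR.pos {b : ℤ → ℝ} (hb : ∀ k, 0 < b k) {n : ℕ} {X Y : Fin (n + 1) → ℤ} {r : ℝ}
    (h : ValidR b X Y r) : 0 < r :=
  (hb _).trans (h (X 0) ⟨0, by omega⟩ ⟨0, by omega⟩)

theorem ValidR.mono {b : ℤ → ℝ} {n : ℕ} {X Y : Fin n → ℤ} {r R : ℝ}
    (h : ValidR b X Y r) (hrR : r ≤ R) : ValidR b X Y R :=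
  fun k h1 h2 => (h k h1 h2).trans_le hrR

theorem Lam_eq_torusIntegral {q : ℝ} (hq : q ∈ Set.Ioo (0 : ℝ) 1) {b : ℤ → ℝ}
    (hb : ∀ k, 0 < b k) {n : ℕ} {Y X : Fin (n + 1) → ℤ} (t : ℝ)
    (σ : Equiv.Perm (Fin (n + 1))) {r R : ℝ} (hX : ValidR b X Y r) (hrR : r ≤ R) :
    Lam q b Y X t σ r = (∏ k, (-1 : ℂ) / (b (X k) : ℂ)) *
      (1 / (2 * Real.pi * Complex.I)) ^ (n + 1) *
        torusIntegral (LamIntegrand q b Y X t σ) 0 (fun _ => R) := by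
  have hr := hX.pos hb
  have hd := fun ρ (hρ : r ≤ ρ) (w : Fin (n + 1) → ℂ) (hw : ∀ i, ‖w i‖ = ρ) =>
    differentiableAt_LamIntegrand hq hb t σ hr hX hρ hw
  rw [← mcInt_eq_torusIntegral (hr.le.trans hrR)
    fun w hw => (hd R hrR w hw).continuousAt.continuousWithinAt,
    mcInt_eq_of_differentiableAt hr hrR hd]
  rfl

theorem eprod_sub_one (f : ℤ → ℂ) (m n : ℤ) (hf : f n ≠ 0) :
    eprod f m (n - 1) = eprod f m n * (f n)⁻¹ := by
  unfold eprod
  rcases lt_trichotomy m (n + 1) with h | h | h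
  · rw [if_pos (by omega), if_pos (by omega),
      ← Finset.insert_Icc_sub_one_right_eq_Icc (show m ≤ n by omega),
      Finset.prod_insert (by simp), mul_comm (f n), mul_assoc, mul_inv_cancel₀ hf, mul_one]
  · subst h
    simp
  · rw [if_neg (by omega), if_neg (by omega), show n - 1 + 1 = n by ring,
      ← Finset.insert_Icc_add_one_left_eq_Icc (show n ≤ m - 1 by omega),
      Finset.prod_insert (by simp), mul_comm]

theorem LamIntegrand_update_sub_one (q : ℝ) {b : ℤ → ℝ} (hb : ∀ k, 0 < b k) {n : ℕ}
    (Y X : Fin n → ℤ) (t : ℝ) (σ : Equiv.Perm (Fin n)) (i : Fin n) {w : Fin n → ℂ}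
    (hw : (b (X i) : ℂ) - w (σ i) ≠ 0) :
    LamIntegrand q b Y (Function.update X i (X i - 1)) t σ w =
      (b (X i) : ℂ)⁻¹ * (LamIntegrand q b Y X t σ w * ((b (X i) : ℂ) - w (σ i))) := by
  have hbi : (b (X i) : ℂ) ≠ 0 := by exact_mod_cast (hb _).ne'
  unfold LamIntegrand
  rw [← Finset.mul_prod_erase _ _ (Finset.mem_univ i),
    ← Finset.mul_prod_erase (a := i) Finset.univ _ (Finset.mem_univ i)]
  rw [Finset.prod_congr rfl fun j hj => by
    rw [Function.update_of_ne (Finset.ne_of_mem_erase hj)]]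
  rw [Function.update_self, eprod_sub_one _ _ _ (div_ne_zero hbi hw)]
  field_simp

theorem prod_neg_one_div_update_sub_one {b : ℤ → ℝ} (hb : ∀ k, 0 < b k) {n : ℕ}
    (X : Fin n → ℤ) (i : Fin n) :
    (b (X i - 1) : ℂ) * ∏ k, (-1 : ℂ) / (b (Function.update X i (X i - 1) k) : ℂ) =
      (b (X i) : ℂ) * ∏ k, (-1 : ℂ) / (b (X k) : ℂ) := by
  have hne : ∀ k, (b k : ℂ) ≠ 0 := fun k => by exact_mod_cast (hb _).ne'
  rw [← Finset.mul_prod_erase _ _ (Finset.mem_univ i),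
    ← Finset.mul_prod_erase (a := i) Finset.univ _ (Finset.mem_univ i)]
  rw [Finset.prod_congr rfl fun j hj => by
    rw [Function.update_of_ne (Finset.ne_of_mem_erase hj)]]
  rw [Function.update_self]
  have := hne (X i)
  have := hne (X i - 1)
  field_simp

theorem mul_Lam_update_sub_one {q : ℝ} (hq : q ∈ Set.Ioo (0 : ℝ) 1) {b : ℤ → ℝ}
    (hb : ∀ k, 0 < b k) {n : ℕ} {Y X : Fin (n + 1) → ℤ} (t : ℝ)
    (σ : Equiv.Perm (Fin (n + 1))) (i : Fin (n + 1)) {r R : ℝ}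
    (hX : ValidR b (Function.update X i (X i - 1)) Y r) (hrR : r ≤ R) (hbR : b (X i) < R) :
    (b (X i - 1) : ℂ) * Lam q b Y (Function.update X i (X i - 1)) t σ r =
      (∏ k, (-1 : ℂ) / (b (X k) : ℂ)) * (1 / (2 * Real.pi * Complex.I)) ^ (n + 1) *
        torusIntegral (fun w => LamIntegrand q b Y X t σ w * ((b (X i) : ℂ) - w (σ i))) 0
          (fun _ => R) := by
  have hbi : (b (X i) : ℂ) ≠ 0 := by exact_mod_cast (hb _).ne'
  rw [Lam_eq_torusIntegral hq hb t σ hX hrR, ← mul_assoc, ← mul_assoc,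
    prod_neg_one_div_update_sub_one hb, torusIntegral_congr ((hb _).trans hbR).le
      fun w hw => LamIntegrand_update_sub_one q hb Y X t σ i
        (ofReal_sub_ne_zero_of_lt_norm (hb _) (by rwa [hw])), torusIntegral_const_mul]
  field_simp

theorem Acoef_mul_swap (q : ℝ) {n : ℕ} (σ : Equiv.Perm (Fin n)) {i j : Fin n}
    (hij : (i : ℕ) + 1 = j) (hσ : σ i < σ j) (w : Fin n → ℂ) :
    Acoef q (σ * Equiv.swap i j) w =
      (-((q : ℂ) * w (σ j) - w (σ i)) / ((q : ℂ) * w (σ i) - w (σ j))) * Acoef q σ w := by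
  have hinv : ∀ c, σ⁻¹ (σ c) = c := σ.symm_apply_apply
  unfold Acoef
  have hnot : (σ j, σ i) ∉ Finset.univ.filter
      (fun p : Fin n × Fin n => p.2 < p.1 ∧ σ⁻¹ p.1 < σ⁻¹ p.2) := by
    simp only [Finset.mem_filter, hinv, not_and, Fin.lt_def]
    omega
  rw [← Finset.prod_insert
    (f := fun p : Fin n × Fin n => -((q : ℂ) * w p.1 - w p.2) / ((q : ℂ) * w p.2 - w p.1)) hnot]
  refine Finset.prod_congr ?_ fun _ _ => rfl
  ext ⟨β, α⟩
  obtain ⟨c, rfl⟩ := σ.surjective β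
  obtain ⟨d, rfl⟩ := σ.surjective α
  simp only [Finset.mem_filter, Finset.mem_univ, true_and, Finset.mem_insert, Prod.mk.injEq,
    mul_inv_rev, Equiv.swap_inv, Equiv.Perm.mul_apply, hinv,
    EmbeddingLike.apply_eq_iff_eq, Equiv.swap_apply_def]
  clear hnot hinv
  have hne : ∀ x : Fin n, x ≠ i → x ≠ j → (x < i ↔ x < j) ∧ (i < x ↔ j < x) := by
    intro x hi hj
    simp only [ne_eq, Fin.ext_iff, Fin.lt_def] at *
    omega
  have hlt : i < j := by
    rw [Fin.lt_def]
    omega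
  by_cases hci : c = i <;> by_cases hcj : c = j <;> by_cases hdi : d = i <;>
    by_cases hdj : d = j <;> simp_all [hlt.ne, hlt.ne', hlt.not_gt, hσ.not_gt]

theorem LamIntegrand_mul_swap_of_lt {q : ℝ} (hq : q ∈ Set.Ioo (0 : ℝ) 1) (b : ℤ → ℝ) {n : ℕ}
    (Y X : Fin n → ℤ) (t : ℝ) (σ : Equiv.Perm (Fin n)) {i j : Fin n} (hij : (i : ℕ) + 1 = j)
    (hX : X i = X j) (hσ : σ i < σ j) {R : ℝ} (hR : 0 < R) {w : Fin n → ℂ}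
    (hw : ∀ k, ‖w k‖ = R) :
    LamIntegrand q b Y X t (σ * Equiv.swap i j) w * ((q : ℂ) * w (σ i) - w (σ j)) =
      -(LamIntegrand q b Y X t σ w * ((q : ℂ) * w (σ j) - w (σ i))) := by
  have hne : (q : ℂ) * w (σ i) - w (σ j) ≠ 0 :=
    ofReal_mul_sub_ne_zero_of_norm_eq hq (norm_pos_iff.1 (by rwa [hw])) (by rw [hw, hw])
  have hXs : ∀ k, X (Equiv.swap i j k) = X k := by
    intro k
    rw [Equiv.swap_apply_def]
    split_ifs <;> simp_all
  have hprod : ∏ k, eprod (fun l => (b l : ℂ) / ((b l : ℂ) - w ((σ * Equiv.swap i j) k)))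
        (Y ((σ * Equiv.swap i j) k)) (X k) =
      ∏ k, eprod (fun l => (b l : ℂ) / ((b l : ℂ) - w (σ k))) (Y (σ k)) (X k) := by
    rw [← Equiv.prod_comp (Equiv.swap i j)
      fun k => eprod (fun l => (b l : ℂ) / ((b l : ℂ) - w (σ k))) (Y (σ k)) (X k)]
    simp only [Equiv.Perm.mul_apply, hXs]
  unfold LamIntegrand
  rw [Finset.prod_mul_distrib, Finset.prod_mul_distrib, hprod, Acoef_mul_swap q σ hij hσ]
  generalize ∏ k, Complex.exp (-(w k) * (t : ℂ)) = E
  field_simp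

theorem LamIntegrand_mul_swap {q : ℝ} (hq : q ∈ Set.Ioo (0 : ℝ) 1) (b : ℤ → ℝ) {n : ℕ}
    (Y X : Fin n → ℤ) (t : ℝ) (σ : Equiv.Perm (Fin n)) {i j : Fin n} (hij : (i : ℕ) + 1 = j)
    (hX : X i = X j) {R : ℝ} (hR : 0 < R) {w : Fin n → ℂ} (hw : ∀ k, ‖w k‖ = R) :
    LamIntegrand q b Y X t (σ * Equiv.swap i j) w * ((q : ℂ) * w (σ i) - w (σ j)) =
      -(LamIntegrand q b Y X t σ w * ((q : ℂ) * w (σ j) - w (σ i))) := by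
  have hne : i ≠ j := by
    rintro rfl
    omega
  rcases lt_or_gt_of_ne (σ.injective.ne hne) with h | h
  · exact LamIntegrand_mul_swap_of_lt hq b Y X t σ hij hX h hR hw
  · have := LamIntegrand_mul_swap_of_lt hq b Y X t (σ * Equiv.swap i j) hij hX (by simpa) hR hw
    simp only [mul_assoc, Equiv.swap_mul_self, mul_one, Equiv.Perm.mul_apply,
      Equiv.swap_apply_left, Equiv.swap_apply_right] at this
    rw [this, neg_neg]

theorem set2_sub_one_left {n : ℕ} (X : Fin n → ℤ) (k : ℕ) (h : k + 1 < n) (x : ℤ) :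
    set2 X k h (x - 1) x =
      Function.update (set2 X k h x x) ⟨k, by omega⟩ (set2 X k h x x ⟨k, by omega⟩ - 1) := by
  ext j
  simp only [set2, Function.update_apply, Fin.ext_iff]
  grind

theorem set2_sub_one_right {n : ℕ} (X : Fin n → ℤ) (k : ℕ) (h : k + 1 < n) (x : ℤ) :
    set2 X k h x (x - 1) =
      Function.update (set2 X k h x x) ⟨k + 1, h⟩ (set2 X k h x x ⟨k + 1, h⟩ - 1) := by
  ext j
  simp only [set2, Function.update_apply, Fin.ext_iff]
  grind

/-- If `X i = X (i + 1)`, the defects of the boundary condition at `σ` and `σ ∘ (i, i + 1)`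
cancel, where the three tuples involved may use different valid contours. -/
theorem Lam_boundary_defect {q : ℝ} (hq : q ∈ Set.Ioo (0 : ℝ) 1) {b : ℤ → ℝ}
    (hb : ∀ k, 0 < b k) {n : ℕ} {Y X : Fin (n + 1) → ℤ} (t : ℝ)
    (σ : Equiv.Perm (Fin (n + 1))) {i j : Fin (n + 1)} (hX : X i = X j) {r₁ r₂ r₃ R : ℝ}
    (h₁ : ValidR b (Function.update X i (X i - 1)) Y r₁)
    (h₂ : ValidR b (Function.update X j (X j - 1)) Y r₂)
    (h₃ : ValidR b X Y r₃) (hR₁ : r₁ ≤ R) (hR₂ : r₂ ≤ R) (hR₃ : r₃ ≤ R) :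
    (b (X i - 1) : ℂ) * Lam q b Y (Function.update X i (X i - 1)) t σ r₁ -
        (q : ℂ) * ((b (X j - 1) : ℂ) * Lam q b Y (Function.update X j (X j - 1)) t σ r₂) -
        (1 - (q : ℂ)) * (b (X i) : ℂ) * Lam q b Y X t σ r₃ =
      (∏ k, (-1 : ℂ) / (b (X k) : ℂ)) * (1 / (2 * Real.pi * Complex.I)) ^ (n + 1) *
        torusIntegral
          (fun w => LamIntegrand q b Y X t σ w * ((q : ℂ) * w (σ j) - w (σ i))) 0
          (fun _ => R) := by
  have hR : ValidR b X Y R := h₃.mono hR₃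
  have hR0 := hR.pos hb
  have hbi : b (X i) < R := hR _ ⟨i, by omega⟩ ⟨i, by omega⟩
  have hcont : ContinuousOn (LamIntegrand q b Y X t σ) {w | ∀ k, ‖w k‖ = R} := fun w hw =>
    (differentiableAt_LamIntegrand hq hb t σ hR0 hR le_rfl hw).continuousAt.continuousWithinAt
  rw [mul_Lam_update_sub_one hq hb t σ i h₁ hR₁ hbi,
    mul_Lam_update_sub_one hq hb t σ j h₂ hR₂ (hX ▸ hbi), Lam_eq_torusIntegral hq hb t σ h₃ hR₃]
  have e : ∀ w : Fin (n + 1) → ℂ, (∀ k, ‖w k‖ = R) →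
      LamIntegrand q b Y X t σ w * ((q : ℂ) * w (σ j) - w (σ i)) =
        LamIntegrand q b Y X t σ w * ((b (X i) : ℂ) - w (σ i)) -
          (q : ℂ) * (LamIntegrand q b Y X t σ w * ((b (X j) : ℂ) - w (σ j))) -
          (1 - (q : ℂ)) * (b (X i) : ℂ) * LamIntegrand q b Y X t σ w := by
    intro w _
    rw [hX]
    ring
  have hI : ∀ k, ContinuousOn
      (fun w => LamIntegrand q b Y X t σ w * ((b (X k) : ℂ) - w (σ k))) {w | ∀ k, ‖w k‖ = R} :=
    fun k => hcont.mul (by fun_prop)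
  rw [torusIntegral_congr hR0.le e, torusIntegral_sub, torusIntegral_sub, torusIntegral_const_mul,
    torusIntegral_const_mul]
  · ring
  · exact torusIntegrable_of_continuousOn hR0.le (hI i)
  · exact torusIntegrable_of_continuousOn hR0.le (continuousOn_const.mul (hI j))
  · exact torusIntegrable_of_continuousOn hR0.le ((hI i).sub (continuousOn_const.mul (hI j)))
  · exact torusIntegrable_of_continuousOn hR0.le (continuousOn_const.mul hcont)

/-- `u⁰_Y(X;t) = Σ_σ Λ_Y(X;t;σ)` satisfies the boundary conditions. -/
theorem bethe_ansatz_boundary_condition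
    (q : ℝ) (hq : q ∈ Set.Ioo (0 : ℝ) 1) (a b : ℤ → ℝ)
    (ha : ∀ i, 0 < a i) (hb : ∀ i, b i = a i * (1 - q))
    (n : ℕ) (Y : Fin (n + 1) → ℤ) (hY : Antitone Y)
    (Rsel : (Fin (n + 1) → ℤ) → ℝ) (hRsel : ∀ X, ValidR b X Y (Rsel X)) :
    BoundaryCond q b
      (fun X t => ∑ σ : Equiv.Perm (Fin (n + 1)), Lam q b Y X t σ (Rsel X)) := by
  have hb0 : ∀ k, 0 < b k := fun k => by
    rw [hb]
    exact mul_pos (ha k) (sub_pos.2 hq.2)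
  intro k h X x t _
  rw [set2_sub_one_left, set2_sub_one_right]
  set Z := set2 X k h x x with hZ
  have hi : Z ⟨k, by omega⟩ = x := by simp [hZ, set2, Fin.ext_iff]
  have hj : Z ⟨k + 1, h⟩ = x := by simp [hZ, set2]
  set i : Fin (n + 1) := ⟨k, by omega⟩
  set j : Fin (n + 1) := ⟨k + 1, h⟩
  have hij : Z i = Z j := hi.trans hj.symm
  have hij' : (i : ℕ) + 1 = j := rfl
  set X₁ := Function.update Z i (Z i - 1) with hX₁
  set X₂ := Function.update Z j (Z j - 1) with hX₂
  set R := max (max (Rsel X₁) (Rsel X₂)) (Rsel Z)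
  have hR₃ : Rsel Z ≤ R := le_max_right _ _
  have hR0 : 0 < R := ((hRsel Z).mono hR₃).pos hb0
  have hD := fun σ => Lam_boundary_defect hq hb0 t σ hij (hRsel X₁) (hRsel X₂) (hRsel Z)
    ((le_max_left _ _).trans (le_max_left _ _)) ((le_max_right _ _).trans (le_max_left _ _)) hR₃
  set D : Equiv.Perm (Fin (n + 1)) → ℂ := fun σ =>
    (∏ k, (-1 : ℂ) / (b (Z k) : ℂ)) * (1 / (2 * Real.pi * Complex.I)) ^ (n + 1) *
      torusIntegral
        (fun w => LamIntegrand q b Y Z t σ w * ((q : ℂ) * w (σ j) - w (σ i))) 0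
        (fun _ => R) with hDdef
  have hanti : ∀ σ, D (σ * Equiv.swap i j) = -D σ := by
    intro σ
    simp only [hDdef, Equiv.Perm.mul_apply, Equiv.swap_apply_left, Equiv.swap_apply_right]
    rw [torusIntegral_congr hR0.le fun w hw =>
      LamIntegrand_mul_swap hq b Y Z t σ hij' hij hR0 hw, torusIntegral_neg, mul_neg]
  have hsum : ∑ σ, D σ = 0 := by
    have h1 := Equiv.sum_comp (Equiv.mulRight (Equiv.swap i j)) D
    simp only [Equiv.coe_mulRight, hanti, Finset.sum_neg_distrib] at h1
    exact neg_eq_self.1 h1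
  have hfinal := Finset.sum_congr (rfl : (Finset.univ : Finset (Equiv.Perm (Fin (n + 1)))) = _)
    fun σ _ => hD σ
  simp only [Finset.sum_sub_distrib, ← Finset.mul_sum] at hfinal
  rw [hi, hj] at hfinal
  simp only [hDdef, ← Finset.mul_sum] at hsum
  rw [hsum] at hfinal
  rw [hX₁, hX₂, hi, hj]
  rw [hX₁, hX₂, hi, hj] at hfinal
  linear_combination hfinal
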